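/- Let λ be a permutation with ides(λ) = 1. If λ has at least two top repetitions, or at least two bottom repetitions, or a top repetition appearing to the right of a bottom repetition, then there is no normal embedding of the permutation 21 into λ (so NE(21,λ)=0) and consequently μ(21,λ) = 0. -/

import Mathlib

open scoped Classical

noncomputable section

/-- A finite permutation: a size `n` together with a permutation of `Fin n`.
Positions and values are 0-indexed here; the paper's 1-indexed sequence
`π(1), …, π(n)` corresponds to the map `p ↦ π(p+1) - 1`. -/
abbrev PPerm : Type := Σ n : ℕ, Equiv.Perm (Fin n)

namespace PPerm

/-- `IsEmb σ π f` : `f` is an embedding of the permutation `σ` into the permutation `π`,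
i.e. `f` is strictly increasing and the values of `π` along `f` are ordered as the values
of `σ`. -/
def IsEmb (σ π : PPerm) (f : Fin σ.1 → Fin π.1) : Prop :=
  StrictMono f ∧ ∀ i j : Fin σ.1, σ.2 i < σ.2 j ↔ π.2 (f i) < π.2 (f j)

/-- The pattern-containment order on finite permutations: `Le σ π` iff some embedding
of `σ` into `π` exists. -/
def Le (σ π : PPerm) : Prop := ∃ f, IsEmb σ π f

lemma Le.size_le {σ π : PPerm} (h : Le σ π) : σ.1 ≤ π.1 := by
  obtain ⟨f, hf⟩ := h
  simpa using Fintype.card_le_of_injective f hf.1.injective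

lemma strictMono_fin_eq_id {n : ℕ} {f : Fin n → Fin n} (hf : StrictMono f) : f = id := by
  have hsurj : Function.Surjective f := Finite.surjective_of_injective hf.injective
  have he : (StrictMono.orderIsoOfSurjective f hf hsurj) = OrderIso.refl (Fin n) :=
    Subsingleton.elim _ _
  funext i
  have h2 := congrArg (fun e : Fin n ≃o Fin n => e i) he
  simpa using h2

lemma Le.eq_of_size_eq {σ π : PPerm} (h : Le σ π) (hs : σ.1 = π.1) : σ = π := by
  obtain ⟨n, s⟩ := σ
  obtain ⟨n', p⟩ := π
  simp only at hs
  subst hs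
  obtain ⟨f, hf, hpat⟩ := h
  have hid : f = id := strictMono_fin_eq_id hf
  subst hid
  have key : ∀ i j, s i < s j ↔ p i < p j := by simpa using hpat
  have hF : StrictMono (fun u => p (s.symm u)) := by
    intro u v huv
    have h1 : s (s.symm u) < s (s.symm v) := by simpa using huv
    exact (key _ _).mp h1
  have hFid : (fun u => p (s.symm u)) = id := strictMono_fin_eq_id hF
  have hps : ∀ w, p w = s w := by
    intro w
    have := congrFun hFid (s w)
    simpa using this
  have : p = s := Equiv.ext hps
  subst this
  rfl

/-- All permutations of size `k`, as a finite set. -/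
def permsOfSize (k : ℕ) : Finset PPerm :=
  Finset.univ.image (fun p : Equiv.Perm (Fin k) => (⟨k, p⟩ : PPerm))

/-- All permutations of size at most `N`, as a finite set. -/
def permsUpTo (N : ℕ) : Finset PPerm :=
  (Finset.range (N + 1)).biUnion permsOfSize

lemma size_le_of_mem_permsUpTo {N : ℕ} {z : PPerm} (h : z ∈ permsUpTo N) : z.1 ≤ N := by
  simp only [permsUpTo, permsOfSize, Finset.mem_biUnion, Finset.mem_range,
    Finset.mem_image, Finset.mem_univ, true_and] at h
  obtain ⟨k, hk, p, rfl⟩ := h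
  show k ≤ N
  omega

/-- The Möbius function of the pattern-containment poset of permutations:
`mu x y = 0` if `x ≰ y`, `mu x x = 1`, and `mu x y = -∑_{z ∈ [x,y)} mu x z` if `x < y`,
where `[x,y)` is the (finite) set of permutations `z` with `x ≤ z ≤ y` and `z ≠ y`. -/
def mu (x y : PPerm) : ℤ :=
  if x = y then 1
  else if ¬ Le x y then 0
  else - ∑ z ∈ ((permsUpTo y.1).filter (fun z => Le x z ∧ Le z y ∧ z ≠ y)).attach,
      mu x z.1
termination_by y.1
decreasing_by
  have hz := z.2
  rw [Finset.mem_filter] at hz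
  obtain ⟨hmem, _, hzy, hne⟩ := hz
  have h1 : z.1.1 ≤ y.1 := size_le_of_mem_permsUpTo hmem
  rcases lt_or_eq_of_le h1 with h | h
  · exact h
  · exact absurd (hzy.eq_of_size_eq h) hne

/-- The closed interval `[x,y]` in the pattern-containment poset, as a finite set. -/
def Icc (x y : PPerm) : Finset PPerm :=
  (permsUpTo y.1).filter (fun z => Le x z ∧ Le z y)

/-- The half-open interval `[x,y)` in the pattern-containment poset, as a finite set. -/
def Ico (x y : PPerm) : Finset PPerm :=
  (Icc x y).filter (fun z => z ≠ y)

/-- `E σ π` : the number of embeddings of `σ` into `π`. -/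
def E (σ π : PPerm) : ℕ := Nat.card {f : Fin σ.1 → Fin π.1 // IsEmb σ π f}

/-- A normal embedding: an embedding whose image contains every non-initial position of
every adjacency of `π`. (A position `p` is a non-initial position of an adjacency of `π`
iff it has an immediate predecessor `q` with `π p = π q + 1`.) -/
def IsNormalEmb (σ π : PPerm) (f : Fin σ.1 → Fin π.1) : Prop :=
  IsEmb σ π f ∧
    ∀ p q : Fin π.1, (p : ℕ) = (q : ℕ) + 1 → ((π.2 p : ℕ) = (π.2 q : ℕ) + 1) →
      p ∈ Set.range f

/-- `NE σ π` : the number of normal embeddings of `σ` into `π`. -/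
def NE (σ π : PPerm) : ℕ := Nat.card {f : Fin σ.1 → Fin π.1 // IsNormalEmb σ π f}

/-- The number of inverse descents of `π`: pairs of positions `i < j` with
`π(i) = π(j) + 1`. -/
def ides (π : PPerm) : ℕ :=
  Nat.card {p : Fin π.1 × Fin π.1 // p.1 < p.2 ∧ ((π.2 p.1 : ℕ) = (π.2 p.2 : ℕ) + 1)}

/-- The unique permutation of size 1. -/
def one : PPerm := ⟨1, Equiv.refl _⟩

/-- The permutation `12`. -/
def perm12 : PPerm := ⟨2, Equiv.refl _⟩

/-- The decreasing permutation `δ_k = k, k-1, …, 1`. -/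
def delta (k : ℕ) : PPerm := ⟨k, Fin.revPerm⟩

/-- The permutation `21`. -/
def perm21 : PPerm := delta 2

/-- The value of `π_n` at the 1-indexed position `i ∈ [1, 2n+2]` (as a 1-indexed value):
`π_n = n+1, 1, n+3, 2, n+4, 3, …, n, 2n+2, n+2`. -/
def piVal (n i : ℕ) : ℕ :=
  if i = 1 then n + 1
  else if i = 2 * n + 2 then n + 2
  else if i % 2 = 0 then i / 2
  else n + 2 + i / 2

/-- The 1-indexed position of the 1-indexed value `v` in `π_n`. -/
def piValInv (n v : ℕ) : ℕ :=
  if v = n + 1 then 1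
  else if v = n + 2 then 2 * n + 2
  else if v ≤ n then 2 * v
  else 2 * (v - n - 2) + 1

/-- The permutation `π_n` as a permutation of `Fin (2n+2)` (0-indexed). -/
def piEquiv (n : ℕ) : Equiv.Perm (Fin (2 * n + 2)) where
  toFun p := ⟨piVal n (p.1 + 1) - 1, by
    have := p.2; unfold piVal; split_ifs <;> omega⟩
  invFun v := ⟨piValInv n (v.1 + 1) - 1, by
    have := v.2; unfold piValInv; split_ifs <;> omega⟩
  left_inv p := by
    have := p.2
    apply Fin.ext
    show piValInv n (piVal n (p.1 + 1) - 1 + 1) - 1 = p.1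
    unfold piVal piValInv
    split_ifs <;> omega
  right_inv v := by
    have := v.2
    apply Fin.ext
    show piVal n (piValInv n (v.1 + 1) - 1 + 1) - 1 = v.1
    unfold piVal piValInv
    split_ifs <;> omega

/-- `π_n` as an element of the permutation poset; it has size `2n+2`. -/
def piPerm (n : ℕ) : PPerm := ⟨2 * n + 2, piEquiv n⟩

/-- `p` is a top position of `π_n`: it carries one of the values `n+3, …, 2n+2`
(1-indexed), i.e. one of the 0-indexed values `n+2, …, 2n+1`. -/
def piTopPos (n : ℕ) (p : Fin (2 * n + 2)) : Prop := n + 2 ≤ ((piEquiv n) p : ℕ)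

/-- `p` is a bottom position of `π_n`: it carries one of the values `1, …, n`
(1-indexed), i.e. one of the 0-indexed values `0, …, n-1`. -/
def piBotPos (n : ℕ) (p : Fin (2 * n + 2)) : Prop := ((piEquiv n) p : ℕ) < n

/-- `k` is a top position of `lam`: for a permutation `lam` with a unique inverse
descent `(i,j)` this says `lam k ≥ lam i`. -/
def IsTopPos (lam : PPerm) (k : Fin lam.1) : Prop :=
  ∃ i j : Fin lam.1, i < j ∧ ((lam.2 i : ℕ) = (lam.2 j : ℕ) + 1) ∧ lam.2 i ≤ lam.2 k

/-- `k` is a bottom position of `lam`: for a permutation `lam` with a unique inverse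
descent `(i,j)` this says `lam k ≤ lam j`. -/
def IsBotPos (lam : PPerm) (k : Fin lam.1) : Prop :=
  ∃ i j : Fin lam.1, i < j ∧ ((lam.2 i : ℕ) = (lam.2 j : ℕ) + 1) ∧ lam.2 k ≤ lam.2 j

/-- A top repetition of `lam` at position `k`: positions `k` and `k+1` are both
top positions. -/
def IsTopRep (lam : PPerm) (k : Fin lam.1) : Prop :=
  ∃ h : (k : ℕ) + 1 < lam.1, IsTopPos lam k ∧ IsTopPos lam ⟨(k : ℕ) + 1, h⟩

/-- A bottom repetition of `lam` at position `k`: positions `k` and `k+1` are both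
bottom positions. -/
def IsBotRep (lam : PPerm) (k : Fin lam.1) : Prop :=
  ∃ h : (k : ℕ) + 1 < lam.1, IsBotPos lam k ∧ IsBotPos lam ⟨(k : ℕ) + 1, h⟩

/-- `lam` is a proper permutation with respect to `π_n`. -/
def IsProper (n : ℕ) (lam : PPerm) : Prop :=
  Le perm21 lam ∧ Le lam (piPerm n) ∧ lam ≠ piPerm n ∧
  ides lam = 1 ∧
  (∀ k : Fin lam.1, (k : ℕ) = 0 → IsTopPos lam k) ∧
  (∀ k : Fin lam.1, (k : ℕ) = 1 → IsBotPos lam k) ∧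
  (∀ k : Fin lam.1, (k : ℕ) = lam.1 - 2 → IsTopPos lam k) ∧
  (∀ k : Fin lam.1, (k : ℕ) = lam.1 - 1 → IsBotPos lam k) ∧
  Nat.card {k : Fin lam.1 // IsTopRep lam k} ≤ 1 ∧
  Nat.card {k : Fin lam.1 // IsBotRep lam k} ≤ 1 ∧
  (∀ k l : Fin lam.1, IsTopRep lam k → IsBotRep lam l → k < l)

/-- `S_lam = ∑_{τ ∈ [lam, π_n]} (-1)^{|τ|} E(τ, π_n)`. -/
def Svals (n : ℕ) (lam : PPerm) : ℤ :=
  ∑ τ ∈ Icc lam (piPerm n), (-1 : ℤ) ^ τ.1 * (E τ (piPerm n) : ℤ)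

/-- `lam` is vanishing (with respect to `π_n`): `μ(21, lam) · S_lam = 0`. -/
def Vanishing (n : ℕ) (lam : PPerm) : Prop := mu perm21 lam * Svals n lam = 0

/-- The reverse-complement of a permutation. -/
def rc (lam : PPerm) : PPerm := ⟨lam.1, (Fin.revPerm.trans lam.2).trans Fin.revPerm⟩

/-- The cup of size `m`: the permutation `(m-1), 1, 2, …, (m-2), m`. -/
def IsCup (lam : PPerm) : Prop :=
  ∀ k : Fin lam.1, (lam.2 k : ℕ) =
    if (k : ℕ) = 0 then lam.1 - 2 else if (k : ℕ) = lam.1 - 1 then lam.1 - 1 else (k : ℕ) - 1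

/-- The cap of size `m`: the permutation `1, 3, 4, …, m, 2`. -/
def IsCap (lam : PPerm) : Prop :=
  ∀ k : Fin lam.1, (lam.2 k : ℕ) =
    if (k : ℕ) = 0 then 0 else if (k : ℕ) = lam.1 - 1 then 1 else (k : ℕ) + 1

/-- `LexLt f f'` : `f` is lexicographically smaller than `f'`, i.e. `f i < f' i` at the
smallest index `i` where they differ. -/
def LexLt {m N : ℕ} (f f' : Fin m → Fin N) : Prop :=
  ∃ i : Fin m, f i < f' i ∧ ∀ j : Fin m, j < i → f j = f' j

/-- `f` is the rightmost (lexicographically greatest) embedding of `lam` into `π_n`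
with image contained in `T`. -/
def IsRightmostIn (n : ℕ) (lam : PPerm) (f : Fin lam.1 → Fin (2 * n + 2))
    (T : Finset (Fin (2 * n + 2))) : Prop :=
  IsEmb lam (piPerm n) f ∧ (∀ i, f i ∈ T) ∧
    ∀ f' : Fin lam.1 → Fin (2 * n + 2), IsEmb lam (piPerm n) f' → (∀ i, f' i ∈ T) →
      f' ≠ f → LexLt f' f

/-- `S_f = ∑_g (-1)^{|g|}`, the sum over all embeddings `g` into `π_n` (of permutations
`τ` with `lam ≤ τ ≤ π_n`) such that `f` is the rightmost embedding of `lam` compatible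
with `g`. Embeddings into `π_n` are identified with their images, which are subsets of
`Fin (2n+2)`. -/
def Sf (n : ℕ) (lam : PPerm) (f : Fin lam.1 → Fin (2 * n + 2)) : ℤ :=
  ∑ T ∈ Finset.univ.filter (fun T : Finset (Fin (2 * n + 2)) => IsRightmostIn n lam f T),
    (-1 : ℤ) ^ T.card

/-- `f` is greedy in a set `S` of positions of `π_n` (for a proper permutation `lam`):
the last element of `lam` goes to the largest bottom-or-right position of `S`, every other
top element of `lam` goes to the largest left-or-top position of `S` below the image of
the next element, and every other bottom element of `lam` goes to the largest bottom
position of `S` below the image of the next element. -/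
def IsGreedyIn (n : ℕ) (lam : PPerm) (S : Set (Fin (2 * n + 2)))
    (f : Fin lam.1 → Fin (2 * n + 2)) : Prop :=
  (∀ i : Fin lam.1, (i : ℕ) = lam.1 - 1 →
    IsGreatest {p : Fin (2 * n + 2) | p ∈ S ∧ (piBotPos n p ∨ (p : ℕ) = 2 * n + 1)} (f i)) ∧
  (∀ (i : Fin lam.1) (hi : (i : ℕ) + 1 < lam.1), IsTopPos lam i →
    IsGreatest {p : Fin (2 * n + 2) |
      p ∈ S ∧ ((p : ℕ) = 0 ∨ piTopPos n p) ∧ p < f ⟨(i : ℕ) + 1, hi⟩} (f i)) ∧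
  (∀ (i : Fin lam.1) (hi : (i : ℕ) + 1 < lam.1), IsBotPos lam i →
    IsGreatest {p : Fin (2 * n + 2) |
      p ∈ S ∧ piBotPos n p ∧ p < f ⟨(i : ℕ) + 1, hi⟩} (f i))

/-- `f` is almost greedy in `S`: `S` contains the rightmost position of `π_n` and `f` is
greedy in `S` with the rightmost position removed. -/
def IsAlmostGreedyIn (n : ℕ) (lam : PPerm) (S : Set (Fin (2 * n + 2)))
    (f : Fin lam.1 → Fin (2 * n + 2)) : Prop :=
  Fin.last (2 * n + 1) ∈ S ∧ IsGreedyIn n lam (S \ {Fin.last (2 * n + 1)}) f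

/-- The value of Smith's permutation `n+1, 1, n+2, 2, …, 2n, n` at the 1-indexed
position `i ∈ [1, 2n]`, as a 1-indexed value: `π(2i-1) = n+i` and `π(2i) = i`. -/
def sVal (n i : ℕ) : ℕ := if i % 2 = 1 then n + (i + 1) / 2 else i / 2

/-- The 1-indexed position of the 1-indexed value `v` in Smith's permutation. -/
def sValInv (n v : ℕ) : ℕ := if v ≤ n then 2 * v else 2 * (v - n) - 1

/-- Smith's permutation `n+1, 1, n+2, 2, …, 2n, n` as a permutation of `Fin (2n)`. -/
def sEquiv (n : ℕ) : Equiv.Perm (Fin (2 * n)) where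
  toFun p := ⟨sVal n (p.1 + 1) - 1, by have := p.2; unfold sVal; split_ifs <;> omega⟩
  invFun v := ⟨sValInv n (v.1 + 1) - 1, by have := v.2; unfold sValInv; split_ifs <;> omega⟩
  left_inv p := by
    have := p.2
    apply Fin.ext
    show sValInv n (sVal n (p.1 + 1) - 1 + 1) - 1 = p.1
    unfold sVal sValInv
    split_ifs <;> omega
  right_inv v := by
    have := v.2
    apply Fin.ext
    show sVal n (sValInv n (v.1 + 1) - 1 + 1) - 1 = v.1
    unfold sVal sValInv
    split_ifs <;> omega

/-- Smith's permutation as an element of the permutation poset; it has size `2n`. -/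
def smithPerm (n : ℕ) : PPerm := ⟨2 * n, sEquiv n⟩

/-! ### Signed counts of normal embeddings of binary words -/

/-- The number of normal embeddings of the word `v` into the word `z`, where `z` is regarded as
preceded by the letter `c` (if any), multiplied by `(-1) ^ (|z| - |v|)`. -/
def signedNE : List Bool → Option Bool → List Bool → ℤ
  | v, _, [] => if v = [] then 1 else 0
  | v, c, a :: z =>
    (if c = some a then 0 else -signedNE v (some a) z) +
      (if v.head? = some a then signedNE v.tail (some a) z else 0)

/-- The set of all subwords of `w`. -/
def subwords (w : List Bool) : Finset (List Bool) := w.sublists.toFinset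

lemma mem_subwords {z w : List Bool} : z ∈ subwords w ↔ z.Sublist w := by
  simp [subwords]

lemma subwords_cons_filter_head_self (a : Bool) (w : List Bool) :
    (subwords (a :: w)).filter (fun z => z.head? = some a) =
      (subwords w).image (List.cons a) := by
  ext z
  cases z with
  | nil => simp
  | cons b z =>
    simp only [Finset.mem_filter, mem_subwords, List.head?_cons, Option.some.injEq,
      Finset.mem_image, List.cons.injEq]
    constructor
    · rintro ⟨h, rfl⟩
      exact ⟨z, List.cons_sublist_cons.mp h, rfl, rfl⟩
    · rintro ⟨y, hy, rfl, rfl⟩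
      exact ⟨List.cons_sublist_cons.mpr hy, rfl⟩

lemma subwords_cons_filter_head_ne {a b : Bool} (hab : b ≠ a) (w : List Bool) :
    (subwords (a :: w)).filter (fun z => z.head? = some b) =
      (subwords w).filter (fun z => z.head? = some b) := by
  ext z
  cases z with
  | nil => simp
  | cons d z =>
    simp only [Finset.mem_filter, mem_subwords, List.head?_cons, Option.some.injEq]
    constructor
    · rintro ⟨h, rfl⟩
      refine ⟨?_, rfl⟩
      cases h with
      | cons _ h => exact h
      | cons_cons _ h => exact absurd rfl hab
    · rintro ⟨h, rfl⟩
      exact ⟨h.cons a, rfl⟩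

lemma sum_subwords_eq_add_heads (g : List Bool → ℤ) (w : List Bool) :
    ∑ z ∈ subwords w, g z = g [] +
      (∑ z ∈ (subwords w).filter (fun z => z.head? = some true), g z +
        ∑ z ∈ (subwords w).filter (fun z => z.head? = some false), g z) := by
  have hnil : ([] : List Bool) ∈ subwords w := mem_subwords.mpr (List.nil_sublist w)
  rw [← Finset.add_sum_erase _ _ hnil, ← Finset.sum_union]
  · congr 2
    ext z
    rcases z with _ | ⟨_ | _, z⟩ <;> simp
  · rw [Finset.disjoint_left]
    intro z h1 h2
    simp_all

lemma suffix_iff_eq_or_cons_suffix (v w : List Bool) :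
    v <:+ w ↔ v = w ∨ (true :: v) <:+ w ∨ (false :: v) <:+ w := by
  constructor
  · rintro ⟨s, rfl⟩
    rcases List.eq_nil_or_concat s with rfl | ⟨s, b, rfl⟩
    · simp
    · cases b
      · exact Or.inr (Or.inr ⟨s, by simp⟩)
      · exact Or.inr (Or.inl ⟨s, by simp⟩)
  · rintro (rfl | h | h)
    · exact List.suffix_refl _
    · exact (List.suffix_cons _ _).trans h
    · exact (List.suffix_cons _ _).trans h

lemma not_cons_suffix_self (b : Bool) (v : List Bool) : ¬ (b :: v) <:+ v := by
  intro h
  have := h.length_le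
  simp at this

lemma cons_suffix_unique {a b : Bool} {v w : List Bool}
    (ha : (a :: v) <:+ w) (hb : (b :: v) <:+ w) : a = b := by
  have h := List.suffix_of_suffix_length_le ha hb (by simp)
  have h2 := h.eq_of_length (by simp)
  simpa using h2

/-- The value of the sum of `signedNE v c` over the subwords of `w` (see `sum_signedNE`). -/
def sufVal (v : List Bool) (c : Option Bool) (w : List Bool) : ℤ :=
  (if v <:+ w then 1 else 0) -
    ((if c ≠ some true ∧ (true :: v) <:+ w then 1 else 0) +
      (if c ≠ some false ∧ (false :: v) <:+ w then 1 else 0))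

lemma sufVal_none (v w : List Bool) : sufVal v none w = if v = w then 1 else 0 := by
  have h0 := suffix_iff_eq_or_cons_suffix v w
  have h1 : (true :: v) <:+ w → (false :: v) <:+ w → False := fun h h' => by
    simpa using cons_suffix_unique h h'
  have h2 := not_cons_suffix_self true v
  have h3 := not_cons_suffix_self false v
  unfold sufVal
  by_cases hv : v = w
  · subst hv
    simp [h2, h3]
  · by_cases h4 : (true :: v) <:+ w <;> by_cases h5 : (false :: v) <:+ w <;> simp_all

lemma sufVal_some (v w : List Bool) (a : Bool) :
    sufVal v (some a) w = if (a :: v) <:+ (a :: w) then 1 else 0 := by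
  have h0 := suffix_iff_eq_or_cons_suffix v w
  have h1 : (true :: v) <:+ w → (false :: v) <:+ w → False := fun h h' => by
    simpa using cons_suffix_unique h h'
  have h2 := not_cons_suffix_self true v
  have h3 := not_cons_suffix_self false v
  have h6 := @List.suffix_cons_iff _ (a :: v) a w
  unfold sufVal
  by_cases hv : v = w
  · subst hv
    cases a <;> simp [h2, h3]
  · by_cases h4 : (true :: v) <:+ w <;> by_cases h5 : (false :: v) <:+ w <;>
      cases a <;> simp_all

lemma sum_signedNE_of_head {w v : List Bool} {c : Option Bool}
    (h : ∀ a : Bool,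
      ∑ z ∈ (subwords w).filter (fun z => z.head? = some a), signedNE v c z =
        (if v.head? = some a ∧ v <:+ w then 1 else 0) -
          (if c ≠ some a ∧ (a :: v) <:+ w then 1 else 0)) :
    ∑ z ∈ subwords w, signedNE v c z = sufVal v c w := by
  rw [sum_subwords_eq_add_heads, h, h, sufVal]
  rcases v with _ | ⟨_ | _, v⟩ <;> simp [signedNE] <;> ring

lemma sum_signedNE_head (w : List Bool) : ∀ (v : List Bool) (c : Option Bool) (a : Bool),
    ∑ z ∈ (subwords w).filter (fun z => z.head? = some a), signedNE v c z =
      (if v.head? = some a ∧ v <:+ w then 1 else 0) -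
        (if c ≠ some a ∧ (a :: v) <:+ w then 1 else 0) := by
  induction w with
  | nil =>
    intro v c a
    have : (subwords []).filter (fun z => z.head? = some a) = ∅ := by
      ext z
      cases z <;> simp [mem_subwords]
    rw [this]
    cases v <;> simp
  | cons d w ih =>
    intro v c a
    by_cases had : a = d
    · subst had
      rw [subwords_cons_filter_head_self, Finset.sum_image (by simp)]
      simp only [signedNE, Finset.sum_add_distrib]
      have key : ∀ u, ∑ z ∈ subwords w, signedNE u (some a) z =
          if (a :: u) <:+ (a :: w) then 1 else 0 := fun u => by
        rw [sum_signedNE_of_head (ih u (some a)), sufVal_some]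
      have h1 : ∑ z ∈ subwords w, (if c = some a then 0 else -signedNE v (some a) z) =
          if c = some a then 0 else -(if (a :: v) <:+ (a :: w) then 1 else 0) := by
        split_ifs with hc hs
        · simp
        · rw [Finset.sum_neg_distrib, key, if_pos hs]
        · rw [Finset.sum_neg_distrib, key, if_neg hs]
      have h2 : ∑ z ∈ subwords w,
          (if v.head? = some a then signedNE v.tail (some a) z else 0) =
          if v.head? = some a ∧ v <:+ (a :: w) then 1 else 0 := by
        rcases v with _ | ⟨b, v⟩
        · simp
        · by_cases hb : b = a
          · subst hb
            simp [key]
          · simp [hb]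
      rw [h1, h2]
      by_cases hc : c = some a
      · simp [hc]
      · simp only [hc, if_false, ne_eq, not_false_eq_true, true_and]
        ring
    · rw [subwords_cons_filter_head_ne had, ih]
      have h1 : (a :: v) <:+ (d :: w) ↔ (a :: v) <:+ w := by
        rw [List.suffix_cons_iff]
        simp [had]
      have h2 : (v.head? = some a ∧ v <:+ (d :: w)) ↔ (v.head? = some a ∧ v <:+ w) := by
        rcases v with _ | ⟨b, v⟩
        · simp
        · simp only [List.head?_cons, Option.some.injEq, List.suffix_cons_iff, List.cons.injEq]
          grind
      simp only [h1, h2]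

/-- The Möbius inversion identity for normal embeddings in the subword order. -/
lemma sum_signedNE (v w : List Bool) :
    ∑ z ∈ subwords w, signedNE v none z = if v = w then 1 else 0 := by
  rw [sum_signedNE_of_head (sum_signedNE_head w v none), sufVal_none]

/-- If `signedNE v c z` does not vanish, then there is a normal embedding of `v` into `z`, given
by its list of positions. -/
lemma exists_positions_of_signedNE_ne_zero (z : List Bool) :
    ∀ (v : List Bool) (c : Option Bool), signedNE v c z ≠ 0 →
      ∃ l : List ℕ, l.SortedLT ∧ l.map (fun i => z[i]?) = v.map some ∧
        (∀ a, c = some a → z[0]? = some a → 0 ∈ l) ∧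
        ∀ (p : ℕ) (a : Bool), z[p]? = some a → z[p + 1]? = some a → p + 1 ∈ l := by
  induction z with
  | nil =>
    intro v c h
    have hv : v = [] := by
      by_contra hv
      simp [signedNE, hv] at h
    exact ⟨[], List.sortedLT_iff_pairwise.mpr List.Pairwise.nil, by simp [hv]⟩
  | cons b z ih =>
    intro v c h
    have hsucc : ∀ l : List ℕ, l.SortedLT → (l.map (· + 1)).SortedLT := by
      intro l hl
      rw [List.sortedLT_iff_pairwise] at hl ⊢
      rw [List.pairwise_map]
      exact hl.imp (by omega)
    rw [signedNE] at h
    by_cases h1 : c ≠ some b ∧ signedNE v (some b) z ≠ 0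
    · obtain ⟨l, hl, hm, h0, hp⟩ := ih v (some b) h1.2
      refine ⟨l.map (· + 1), hsucc l hl, ?_, ?_, ?_⟩
      · simpa [Function.comp_def] using hm
      · intro a ha hb
        simp only [List.getElem?_cons_zero] at hb
        exact absurd (ha.trans hb.symm) h1.1
      · intro p a ha hb
        rcases p with _ | p
        · simp only [List.getElem?_cons_zero, List.getElem?_cons_succ, zero_add] at ha hb
          simpa using h0 a ha hb
        · simp only [List.getElem?_cons_succ] at ha hb
          simpa using hp p a ha hb
    · have h2 : v.head? = some b ∧ signedNE v.tail (some b) z ≠ 0 := by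
        by_contra h2
        apply h
        grind
      obtain ⟨l, hl, hm, h0, hp⟩ := ih v.tail (some b) h2.2
      refine ⟨0 :: l.map (· + 1), ?_, ?_, ?_, ?_⟩
      · have := hsucc l hl
        rw [List.sortedLT_iff_pairwise] at this ⊢
        rw [List.pairwise_cons]
        exact ⟨by simp, this⟩
      · rcases v with _ | ⟨d, v⟩
        · simp at h2
        · simp only [List.head?_cons, Option.some.injEq] at h2
          simpa [Function.comp_def, h2.1] using hm
      · simp
      · intro p a ha hb
        rcases p with _ | p
        · simp only [List.getElem?_cons_zero, List.getElem?_cons_succ, zero_add] at ha hb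
          simpa using h0 a ha hb
        · simp only [List.getElem?_cons_succ] at ha hb
          simpa using hp p a ha hb

lemma sublist_of_signedNE_ne_zero (z : List Bool) :
    ∀ (v : List Bool) (c : Option Bool), signedNE v c z ≠ 0 → v.Sublist z := by
  induction z with
  | nil =>
    intro v c h
    by_contra hv
    simp_all [signedNE]
  | cons b z ih =>
    intro v c h
    rw [signedNE] at h
    by_cases h1 : signedNE v (some b) z = 0
    · rcases v with _ | ⟨d, v⟩
      · simp
      · have hd : d = b ∧ signedNE v (some b) z ≠ 0 := by
          simp only [h1, neg_zero, ite_self, zero_add, List.head?_cons, List.tail_cons,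
            Option.some.injEq, ne_eq, ite_eq_right_iff, Classical.not_imp] at h
          exact h
        obtain ⟨rfl, hd⟩ := hd
        exact (ih v _ hd).cons_cons d
    · exact (ih v _ h1).cons b

/-! ### Permutations that stably sort a binary word -/

/-- `σ` orders positions first by the letter of `b`, then from left to right. -/
def IsShuffle (σ : PPerm) (b : Fin σ.1 → Bool) : Prop :=
  ∀ i j : Fin σ.1, σ.2 i < σ.2 j ↔ (b i < b j ∨ b i = b j ∧ i < j)

lemma exists_isShuffle (n : ℕ) (b : Fin n → Bool) :
    ∃ s : Equiv.Perm (Fin n), IsShuffle ⟨n, s⟩ b := by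
  let key : Fin n → Bool ×ₗ Fin n := fun i => toLex (b i, i)
  have hkey : Function.Injective key := by
    intro i j h
    exact congrArg (fun x => (ofLex x).2) h
  have hcard : (Finset.univ.image key).card = n := by
    rw [Finset.card_image_of_injective _ hkey]
    simp
  let e := Finset.orderIsoOfFin _ hcard
  let g : Fin n → Fin n := fun i => e.symm ⟨key i, by simp⟩
  have hg : ∀ i j, g i < g j ↔ (b i < b j ∨ b i = b j ∧ i < j) := by
    intro i j
    simp only [g, OrderIso.lt_iff_lt, Subtype.mk_lt_mk, key, Prod.Lex.toLex_lt_toLex]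
  have hinj : Function.Injective g := by
    intro i j h
    have := e.symm.injective h
    exact hkey (by simpa using this)
  exact ⟨Equiv.ofBijective g (Finite.injective_iff_bijective.mp hinj), hg⟩

/-- The permutation stably sorting the binary word `z`. -/
def ofWord (z : List Bool) : PPerm := ⟨z.length, (exists_isShuffle z.length z.get).choose⟩

lemma isShuffle_ofWord (z : List Bool) : IsShuffle (ofWord z) z.get :=
  (exists_isShuffle z.length z.get).choose_spec

lemma IsShuffle.isEmb {σ τ : PPerm} {b : Fin σ.1 → Bool} {d : Fin τ.1 → Bool}
    (hσ : IsShuffle σ b) (hτ : IsShuffle τ d) {f : Fin σ.1 → Fin τ.1} (hf : StrictMono f)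
    (h : ∀ i, d (f i) = b i) : IsEmb σ τ f := by
  refine ⟨hf, fun i j => ?_⟩
  rw [hσ, hτ, h, h, hf.lt_iff_lt]

lemma IsEmb.isShuffle {σ τ : PPerm} {d : Fin τ.1 → Bool} {f : Fin σ.1 → Fin τ.1}
    (hf : IsEmb σ τ f) (hτ : IsShuffle τ d) : IsShuffle σ (fun i => d (f i)) := by
  intro i j
  rw [hf.2, hτ, hf.1.lt_iff_lt]

lemma IsShuffle.eq_ofWord {σ : PPerm} {b : Fin σ.1 → Bool} (h : IsShuffle σ b) :
    σ = ofWord (List.ofFn b) := by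
  have hs : (List.ofFn b).length = σ.1 := List.length_ofFn
  refine Le.eq_of_size_eq ⟨Fin.cast hs.symm, ?_⟩ hs.symm
  refine h.isEmb (isShuffle_ofWord _) (fun i j hij => hij) fun i => ?_
  exact (List.get_ofFn b (Fin.cast hs.symm i)).trans rfl

lemma IsShuffle.lt_of_inversion {σ : PPerm} {b : Fin σ.1 → Bool} (h : IsShuffle σ b)
    {i j : Fin σ.1} (hij : i < j) : σ.2 j < σ.2 i ↔ b i = true ∧ b j = false := by
  rw [h]
  have := hij.not_gt
  cases b i <;> cases b j <;> simp [this]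

lemma IsShuffle.unique {σ : PPerm} {b d : Fin σ.1 → Bool} (hb : IsShuffle σ b)
    (hd : IsShuffle σ d) (hne : ∃ i j, i < j ∧ b i = true ∧ b j = false) : b = d := by
  obtain ⟨i, j, hij, hi, hj⟩ := hne
  have key : ∀ k l : Fin σ.1, k < l → (b k = true ∧ b l = false ↔ d k = true ∧ d l = false) :=
    fun k l hkl => by rw [← hb.lt_of_inversion hkl, ← hd.lt_of_inversion hkl]
  have hdij := (key i j hij).mp ⟨hi, hj⟩
  funext k
  have h1 := key i k
  have h2 := key k j
  by_cases hik : i < k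
  · have := h1 hik
    cases hbk : b k <;> cases hdk : d k <;> simp_all
  · have := h2 (lt_of_le_of_lt (not_lt.mp hik) hij)
    cases hbk : b k <;> cases hdk : d k <;> simp_all

lemma le_ofWord_iff {σ : PPerm} {w : List Bool} :
    Le σ (ofWord w) ↔ ∃ z : List Bool, z.Sublist w ∧ σ = ofWord z := by
  constructor
  · rintro ⟨f, hf⟩
    refine ⟨List.ofFn (fun i => w.get (f i)), ?_, (hf.isShuffle (isShuffle_ofWord w)).eq_ofWord⟩
    rw [List.sublist_iff_exists_fin_orderEmbedding_get_eq]
    have hs : (List.ofFn (fun i => w.get (f i))).length = σ.1 := List.length_ofFn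
    refine ⟨OrderEmbedding.ofStrictMono (fun i => f (Fin.cast hs i)) fun i j hij => hf.1 hij, ?_⟩
    exact fun i => List.get_ofFn (fun i => w.get (f i)) i
  · rintro ⟨z, hz, rfl⟩
    rw [List.sublist_iff_exists_fin_orderEmbedding_get_eq] at hz
    obtain ⟨f, hf⟩ := hz
    exact ⟨f, (isShuffle_ofWord z).isEmb (isShuffle_ofWord w) f.strictMono fun i => (hf i).symm⟩

lemma isShuffle_perm21 : IsShuffle perm21 (fun i : Fin 2 => decide (i = 0)) := by
  have : ∀ i j : Fin 2, (Fin.revPerm i < Fin.revPerm j ↔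
      (decide (i = 0) < decide (j = 0) ∨ decide (i = 0) = decide (j = 0) ∧ i < j)) := by
    decide
  exact this

lemma perm21_eq_ofWord : perm21 = ofWord [true, false] :=
  isShuffle_perm21.eq_ofWord

lemma sublist_iff_exists_inversion {z : List Bool} :
    [true, false].Sublist z ↔
      ∃ i j : Fin z.length, i < j ∧ z.get i = true ∧ z.get j = false := by
  rw [List.sublist_iff_exists_fin_orderEmbedding_get_eq]
  constructor
  · rintro ⟨f, hf⟩
    exact ⟨f 0, f 1, f.strictMono (by decide), (hf 0).symm, (hf 1).symm⟩
  · rintro ⟨i, j, hij, hi, hj⟩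
    refine ⟨OrderEmbedding.ofStrictMono (![i, j] : Fin 2 → Fin z.length) ?_, ?_⟩
    · intro k l hkl
      change Fin 2 at k l
      change (k : Fin 2) < l at hkl
      change (![i, j] : Fin 2 → Fin z.length) k < (![i, j] : Fin 2 → Fin z.length) l
      obtain ⟨rfl, rfl⟩ : k = 0 ∧ l = 1 := by omega
      exact hij
    · intro k
      change Fin 2 at k
      fin_cases k
      · exact hi.symm
      · exact hj.symm

lemma ofWord_injOn : Set.InjOn ofWord {z | [true, false].Sublist z} := by
  intro z hz y _ hzy
  have hlen : z.length = y.length := congrArg Sigma.fst hzy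
  have hz' := sublist_iff_exists_inversion.mp hz
  have h1 := isShuffle_ofWord z
  have h2 : IsShuffle (ofWord z) (fun i => y.get (Fin.cast hlen i)) := by
    have hy := isShuffle_ofWord y
    have hE : ∀ (σ τ : PPerm) (e : σ = τ), IsEmb σ τ (Fin.cast (congrArg Sigma.fst e)) := by
      rintro σ _ rfl
      exact ⟨fun i j hij => hij, fun i j => Iff.rfl⟩
    exact (hE _ _ hzy).isShuffle hy
  have h3 := h1.unique h2 hz'
  refine List.ext_get hlen fun n hn hn' => ?_
  exact congrFun h3 ⟨n, hn⟩

lemma perm21_le_ofWord_iff {z : List Bool} : Le perm21 (ofWord z) ↔ [true, false].Sublist z := by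
  constructor
  · rintro ⟨f, hf⟩
    rw [sublist_iff_exists_inversion]
    have h01 : f (0 : Fin 2) < f (1 : Fin 2) := hf.1 (by decide : (0 : Fin 2) < 1)
    have h10 := (hf.2 (1 : Fin 2) (0 : Fin 2)).mp
      (by decide : Fin.revPerm (1 : Fin 2) < Fin.revPerm (0 : Fin 2))
    exact ⟨_, _, h01, ((isShuffle_ofWord z).lt_of_inversion h01).mp h10⟩
  · intro h
    rw [le_ofWord_iff]
    exact ⟨_, h, perm21_eq_ofWord⟩

/-! ### The Möbius function -/

lemma mem_permsUpTo {N : ℕ} {σ : PPerm} : σ ∈ permsUpTo N ↔ σ.1 ≤ N := by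
  refine ⟨size_le_of_mem_permsUpTo, fun h => ?_⟩
  simp only [permsUpTo, permsOfSize, Finset.mem_biUnion, Finset.mem_range,
    Finset.mem_image, Finset.mem_univ, true_and]
  exact ⟨σ.1, by omega, σ.2, rfl⟩

lemma mu_self (x : PPerm) : mu x x = 1 := by
  rw [mu, if_pos rfl]

lemma mu_of_lt {x y : PPerm} (hne : x ≠ y) (hle : Le x y) :
    mu x y = -∑ z ∈ Ico x y, mu x z := by
  rw [mu, if_neg hne, if_neg (not_not.mpr hle),
    Finset.sum_attach ((permsUpTo y.1).filter (fun z => Le x z ∧ Le z y ∧ z ≠ y)) (mu x)]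
  congr 2
  ext z
  simp [Ico, Icc, and_assoc]

lemma Ico_perm21_ofWord {w : List Bool} (hw : [true, false].Sublist w) :
    Ico perm21 (ofWord w) =
      ((subwords w).filter (fun z => [true, false].Sublist z ∧ z ≠ w)).image ofWord := by
  ext σ
  simp only [Ico, Icc, Finset.mem_filter, mem_permsUpTo, Finset.mem_image, mem_subwords]
  constructor
  · rintro ⟨⟨_, h21, hle⟩, hne⟩
    obtain ⟨z, hz, rfl⟩ := le_ofWord_iff.mp hle
    exact ⟨z, ⟨hz, perm21_le_ofWord_iff.mp h21, fun h => hne (congrArg ofWord h)⟩, rfl⟩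
  · rintro ⟨z, ⟨hz, h21, hne⟩, rfl⟩
    exact ⟨⟨hz.length_le, perm21_le_ofWord_iff.mpr h21, le_ofWord_iff.mpr ⟨z, hz, rfl⟩⟩,
      fun h => hne (ofWord_injOn h21 hw h)⟩

/-- The Möbius function on an interval whose bottom is `21` and whose top stably sorts a binary
word is the signed number of normal embeddings. -/
lemma mu_perm21_ofWord (w : List Bool) (hw : [true, false].Sublist w) :
    mu perm21 (ofWord w) = signedNE [true, false] none w := by
  induction hn : w.length using Nat.strong_induction_on generalizing w with
  | _ n ih =>
    by_cases h : w = [true, false]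
    · subst h
      rw [← perm21_eq_ofWord, mu_self]
      simp [signedNE]
    · have hne : perm21 ≠ ofWord w := by
        rw [perm21_eq_ofWord]
        exact fun he => h (ofWord_injOn (List.Sublist.refl _) hw he).symm
      have hself : w ∈ subwords w := mem_subwords.mpr (List.Sublist.refl w)
      have hsum := sum_signedNE [true, false] w
      rw [if_neg (Ne.symm h), ← Finset.add_sum_erase _ _ hself] at hsum
      rw [mu_of_lt hne (perm21_le_ofWord_iff.mpr hw), Ico_perm21_ofWord hw,
        Finset.sum_image (fun x hx y hy hxy => ofWord_injOn (by simp_all) (by simp_all) hxy)]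
      rw [eq_neg_of_add_eq_zero_left hsum, neg_inj]
      trans ∑ z ∈ (subwords w).filter (fun z => [true, false].Sublist z ∧ z ≠ w),
        signedNE [true, false] none z
      · refine Finset.sum_congr rfl fun z hz => ?_
        simp only [Finset.mem_filter, mem_subwords] at hz
        refine ih z.length ?_ z hz.2.1 rfl
        rw [← hn]
        exact lt_of_le_of_ne hz.1.length_le fun he => hz.2.2 (hz.1.eq_of_length he)
      · refine Finset.sum_subset ?_ ?_
        · intro z hz
          simp_all
        · intro z hz hz'
          by_contra hne0
          have := sublist_of_signedNE_ne_zero _ _ _ hne0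
          simp_all

/-! ### Permutations with one inverse descent -/

lemma exists_unique_inverse_descent {lam : PPerm} (h : ides lam = 1) :
    ∃ i j : Fin lam.1, i < j ∧ (lam.2 i : ℕ) = (lam.2 j : ℕ) + 1 ∧
      ∀ k l : Fin lam.1, k < l → (lam.2 k : ℕ) = (lam.2 l : ℕ) + 1 → k = i ∧ l = j := by
  rw [ides, Nat.card_eq_one_iff_exists] at h
  obtain ⟨⟨⟨i, j⟩, hij, hd⟩, hu⟩ := h
  refine ⟨i, j, hij, hd, fun k l hkl hd' => ?_⟩
  have := hu ⟨⟨k, l⟩, hkl, hd'⟩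
  simpa using this

lemma isBotPos_iff_not_isTopPos {lam : PPerm} (h : ides lam = 1) (k : Fin lam.1) :
    IsBotPos lam k ↔ ¬ IsTopPos lam k := by
  obtain ⟨i, j, hij, hd, hu⟩ := exists_unique_inverse_descent h
  constructor
  · rintro ⟨a, b, hab, hd1, hk⟩ ⟨a', b', hab', hd2, hk'⟩
    obtain ⟨rfl, rfl⟩ := hu a b hab hd1
    obtain ⟨rfl, rfl⟩ := hu a' b' hab' hd2
    rw [Fin.le_def] at hk hk'
    omega
  · intro hk
    refine ⟨i, j, hij, hd, ?_⟩
    by_contra hlt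
    refine hk ⟨i, j, hij, hd, ?_⟩
    rw [Fin.le_def] at hlt ⊢
    omega

lemma isShuffle_of_ides_eq_one {lam : PPerm} (h : ides lam = 1) :
    IsShuffle lam (fun k => decide (IsTopPos lam k)) := by
  obtain ⟨i, j, hij, hd, hu⟩ := exists_unique_inverse_descent h
  have htop : ∀ k, IsTopPos lam k ↔ lam.2 i ≤ lam.2 k := by
    intro k
    constructor
    · rintro ⟨a, b, hab, hd1, hk⟩
      obtain ⟨rfl, rfl⟩ := hu a b hab hd1
      exact hk
    · exact fun hk => ⟨i, j, hij, hd, hk⟩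
  have mono : ∀ (m : ℕ) (k l : Fin lam.1), (lam.2 l : ℕ) = lam.2 k + m + 1 →
      (lam.2 i ≤ lam.2 k ↔ lam.2 i ≤ lam.2 l) → k < l := by
    intro m
    induction m with
    | zero =>
      intro k l hkl hs
      by_contra hlt
      have hne : k ≠ l := by
        rintro rfl
        omega
      obtain ⟨rfl, rfl⟩ := hu l k (lt_of_le_of_ne (not_lt.mp hlt) hne.symm) (by omega)
      simp only [Fin.le_def] at hs
      omega
    | succ m ih =>
      intro k l hkl hs
      have hb := (lam.2 l).isLt
      obtain ⟨x, hx⟩ := lam.2.surjective ⟨lam.2 k + m + 1, by omega⟩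
      have hx' : (lam.2 x : ℕ) = lam.2 k + m + 1 := by rw [hx]
      simp only [Fin.le_def] at hs ih
      have h1 := ih k x hx' (by omega)
      by_contra hlt
      have hne : x ≠ l := by
        rintro rfl
        omega
      obtain ⟨rfl, rfl⟩ := hu l x (lt_of_le_of_ne (by omega) hne.symm) (by omega)
      omega
  have mono' : ∀ k l : Fin lam.1, lam.2 k < lam.2 l →
      (lam.2 i ≤ lam.2 k ↔ lam.2 i ≤ lam.2 l) → k < l := by
    intro k l hkl hs
    rw [Fin.lt_def] at hkl
    exact mono (lam.2 l - lam.2 k - 1) k l (by omega) hs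
  intro k l
  simp only [htop]
  constructor
  · intro hkl
    by_cases hs : lam.2 i ≤ lam.2 k ↔ lam.2 i ≤ lam.2 l
    · exact Or.inr ⟨by simp [hs], mono' k l hkl hs⟩
    · left
      have h1 : ¬ lam.2 i ≤ lam.2 k := fun h1 => hs ⟨fun _ => h1.trans hkl.le, fun _ => h1⟩
      have h2 : lam.2 i ≤ lam.2 l := by
        by_contra h2
        exact hs ⟨fun h => absurd h h1, fun h => absurd h h2⟩
      simp [h1, h2]
  · rintro (hlt | ⟨he, hkl⟩)
    · rw [Bool.lt_iff] at hlt
      simp only [decide_eq_false_iff_not, decide_eq_true_eq, not_le] at hlt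
      exact hlt.1.trans_le hlt.2
    · rw [decide_eq_decide] at he
      by_contra hlt
      rcases (not_lt.mp hlt).lt_or_eq with h1 | h1
      · exact absurd (mono' l k h1 he.symm) hkl.not_gt
      · exact absurd (lam.2.injective h1) hkl.ne'

lemma IsShuffle.succ_of_repetition {σ : PPerm} {b : Fin σ.1 → Bool} (h : IsShuffle σ b)
    {p q : Fin σ.1} (hpq : (p : ℕ) = q + 1) (hb : b q = b p) :
    (σ.2 p : ℕ) = (σ.2 q : ℕ) + 1 := by
  have hlt : σ.2 q < σ.2 p := (h q p).mpr (Or.inr ⟨hb, by rw [Fin.lt_def]; omega⟩)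
  by_contra hne
  have hbound := (σ.2 p).isLt
  obtain ⟨x, hx⟩ := σ.2.surjective ⟨σ.2 q + 1, by rw [Fin.lt_def] at hlt; omega⟩
  have hx' : (σ.2 x : ℕ) = σ.2 q + 1 := by rw [hx]
  rw [Fin.lt_def] at hlt
  have h1 := (h q x).mp (by rw [Fin.lt_def]; omega)
  have h2 := (h x p).mp (by rw [Fin.lt_def]; omega)
  simp only [Bool.lt_iff, Fin.lt_def] at h1 h2
  grind

/-- `p` is the second position of a repetition of the word `b`. -/
def IsRepAt {n : ℕ} (b : Fin n → Bool) (p : Fin n) : Prop :=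
  ∃ q : Fin n, (p : ℕ) = q + 1 ∧ b q = b p

lemma exists_repetitions {lam : PPerm} (h : ides lam = 1)
    (hcase : 2 ≤ Nat.card {k : Fin lam.1 // IsTopRep lam k} ∨
             2 ≤ Nat.card {k : Fin lam.1 // IsBotRep lam k} ∨
             ∃ k l : Fin lam.1, IsBotRep lam k ∧ IsTopRep lam l ∧ k < l) :
    ∃ p q : Fin lam.1, p < q ∧ IsRepAt (fun k => decide (IsTopPos lam k)) p ∧
      IsRepAt (fun k => decide (IsTopPos lam k)) q ∧ ¬ (IsTopPos lam p ∧ ¬ IsTopPos lam q) := by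
  have htop : ∀ k, IsTopRep lam k → ∃ p : Fin lam.1, (p : ℕ) = k + 1 ∧ IsTopPos lam p ∧
      IsRepAt (fun k => decide (IsTopPos lam k)) p := by
    rintro k ⟨hk, h1, h2⟩
    exact ⟨⟨k + 1, hk⟩, rfl, h2, k, rfl, by simp [h1, h2]⟩
  have hbot : ∀ k, IsBotRep lam k → ∃ p : Fin lam.1, (p : ℕ) = k + 1 ∧ ¬ IsTopPos lam p ∧
      IsRepAt (fun k => decide (IsTopPos lam k)) p := by
    rintro k ⟨hk, h1, h2⟩
    rw [isBotPos_iff_not_isTopPos h] at h1 h2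
    exact ⟨⟨k + 1, hk⟩, rfl, h2, k, rfl, by simp [h1, h2]⟩
  have hpair : ∀ P : Fin lam.1 → Prop, 2 ≤ Nat.card {k : Fin lam.1 // P k} →
      ∃ k l, P k ∧ P l ∧ k < l := by
    intro P hP
    have : Nontrivial {k : Fin lam.1 // P k} := Finite.one_lt_card_iff_nontrivial.mp hP
    obtain ⟨⟨k, hk⟩, ⟨l, hl⟩, hkl⟩ := exists_pair_ne {k : Fin lam.1 // P k}
    rcases lt_or_gt_of_ne (fun e => hkl (Subtype.ext e) : k ≠ l) with hlt | hlt
    · exact ⟨k, l, hk, hl, hlt⟩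
    · exact ⟨l, k, hl, hk, hlt⟩
  rcases hcase with hc | hc | ⟨k, l, hk, hl, hkl⟩
  · obtain ⟨k, l, hk, hl, hkl⟩ := hpair _ hc
    obtain ⟨p, hp, hpt, hpr⟩ := htop k hk
    obtain ⟨q, hq, hqt, hqr⟩ := htop l hl
    exact ⟨p, q, by rw [Fin.lt_def] at *; omega, hpr, hqr, fun hn => hn.2 hqt⟩
  · obtain ⟨k, l, hk, hl, hkl⟩ := hpair _ hc
    obtain ⟨p, hp, hpt, hpr⟩ := hbot k hk
    obtain ⟨q, hq, hqt, hqr⟩ := hbot l hl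
    exact ⟨p, q, by rw [Fin.lt_def] at *; omega, hpr, hqr, fun hn => hpt hn.1⟩
  · obtain ⟨p, hp, hpt, hpr⟩ := hbot k hk
    obtain ⟨q, hq, hqt, hqr⟩ := htop l hl
    exact ⟨p, q, by rw [Fin.lt_def] at *; omega, hpr, hqr, fun hn => hpt hn.1⟩

lemma signedNE_ofFn_eq_zero {n : ℕ} {b : Fin n → Bool} {p q : Fin n} (hpq : p < q)
    (hp : IsRepAt b p) (hq : IsRepAt b q) (hb : ¬ (b p = true ∧ b q = false)) :
    signedNE [true, false] none (List.ofFn b) = 0 := by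
  by_contra hne
  obtain ⟨l, hl, hm, _, hrep⟩ := exists_positions_of_signedNE_ne_zero _ _ _ hne
  have hmem : ∀ r : Fin n, IsRepAt b r → (r : ℕ) ∈ l := by
    rintro r ⟨s, hs, hbs⟩
    rw [hs]
    refine hrep s (b r) ?_ ?_
    · simp [← hbs]
    · rw [← hs]
      simp
  have h1 := hmem p hp
  have h2 := hmem q hq
  have hlen : l.length = 2 := by simpa using congrArg List.length hm
  obtain ⟨i, j, rfl⟩ := List.length_eq_two.mp hlen
  rw [List.sortedLT_iff_pairwise] at hl
  simp only [List.pairwise_cons, List.mem_cons, List.not_mem_nil, or_false, forall_eq] at hl h1 h2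
  rw [Fin.lt_def] at hpq
  obtain ⟨rfl, rfl⟩ : (p : ℕ) = i ∧ (q : ℕ) = j := by omega
  simp at hm
  exact hb hm

lemma IsShuffle.not_isNormalEmb_perm21 {σ : PPerm} {b : Fin σ.1 → Bool} (h : IsShuffle σ b)
    {p q : Fin σ.1} (hpq : p < q) (hp : IsRepAt b p) (hq : IsRepAt b q)
    (hb : ¬ (b p = true ∧ b q = false)) (f : Fin perm21.1 → Fin σ.1) :
    ¬ IsNormalEmb perm21 σ f := by
  rintro ⟨hf, hn⟩
  have hmem : ∀ r, IsRepAt b r → ∃ k : Fin 2, f k = r := by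
    rintro r ⟨s, hs, hbs⟩
    exact hn r s hs (h.succ_of_repetition hs hbs)
  obtain ⟨k, rfl⟩ := hmem p hp
  obtain ⟨l, rfl⟩ := hmem q hq
  have hkl : (k : Fin 2) < l := hf.1.lt_iff_lt.mp hpq
  have h0 : k = 0 := by omega
  have h1 : l = 1 := by omega
  subst h0 h1
  have h10 := (hf.2 (1 : Fin 2) (0 : Fin 2)).mp
    (by decide : Fin.revPerm (1 : Fin 2) < Fin.revPerm (0 : Fin 2))
  exact hb ((h.lt_of_inversion hpq).mp h10)

/-- If `ides λ = 1` and `λ` has at least two top repetitions, or at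
least two bottom repetitions, or a top repetition to the right of a bottom repetition,
then `21` has no normal embedding into `λ` (so `NE(21,λ) = 0`) and `μ(21,λ) = 0`. -/
theorem mu_perm21_eq_zero_of_reps (lam : PPerm) (h : ides lam = 1)
    (hcase : 2 ≤ Nat.card {k : Fin lam.1 // IsTopRep lam k} ∨
             2 ≤ Nat.card {k : Fin lam.1 // IsBotRep lam k} ∨
             ∃ k l : Fin lam.1, IsBotRep lam k ∧ IsTopRep lam l ∧ k < l) :
    (¬ ∃ f, IsNormalEmb perm21 lam f) ∧ NE perm21 lam = 0 ∧ mu perm21 lam = 0 := by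
  have hsh := isShuffle_of_ides_eq_one h
  obtain ⟨p, q, hpq, hp, hq, hb⟩ := exists_repetitions h hcase
  have hb' : ¬ (decide (IsTopPos lam p) = true ∧ decide (IsTopPos lam q) = false) := by
    simpa using hb
  have hno : ¬ ∃ f, IsNormalEmb perm21 lam f := by
    rintro ⟨f, hf⟩
    exact hsh.not_isNormalEmb_perm21 hpq hp hq hb' f hf
  refine ⟨hno, ?_, ?_⟩
  · have : IsEmpty {f : Fin perm21.1 → Fin lam.1 // IsNormalEmb perm21 lam f} :=
      ⟨fun f => hno ⟨f.1, f.2⟩⟩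
    exact Nat.card_of_isEmpty
  · rw [hsh.eq_ofWord]
    by_cases hw : [true, false].Sublist (List.ofFn fun k => decide (IsTopPos lam k))
    · rw [mu_perm21_ofWord _ hw]
      exact signedNE_ofFn_eq_zero hpq hp hq hb'
    · have hle : ¬ Le perm21 (ofWord (List.ofFn fun k => decide (IsTopPos lam k))) :=
        fun hle => hw (perm21_le_ofWord_iff.mp hle)
      have hne : perm21 ≠ ofWord (List.ofFn fun k => decide (IsTopPos lam k)) := by
        intro he
        exact hle (he ▸ ⟨id, strictMono_id, fun _ _ => Iff.rfl⟩)
      rw [mu, if_neg hne, if_pos hle]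

end PPerm

end
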